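/- arXiv:1803.01314 — 3 statements merged into one kernel-verified Lean document; each statement's English description precedes it below -/
import Mathlib

section
/- Fix K ≥ 1, σ > 0 and x ∈ ℝ^K. Let n be a random vector in ℝ^K whose coordinates are independent with common distribution N(0, σ²), and set y = x + n. Let h : ℝ^K → ℝ^K be continuously differentiable, and assume that for every i the functions y ↦ n_i·h_i(y) and y ↦ (∂h_i/∂y_i)(y) are integrable with respect to the joint law. Then E[nᵀ h(y)] = σ² · E[Σ_{i=1}^K (∂h_i/∂y_i)(y)]. -/
open MeasureTheory ProbabilityTheory

/-- The law of a random vector in `ℝ^K` whose coordinates are independent with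
common distribution `N(0, σ²)`. -/
noncomputable def gaussPi (K : ℕ) (σ : ℝ) : Measure (Fin K → ℝ) :=
  Measure.pi fun _ => gaussianReal 0 (σ ^ 2).toNNReal

/-- The Gaussian density solves the first-order equation `v φ'(t) = -t φ(t)`. -/
lemma hasDerivAt_gaussianPDFReal_zero_mean {v : NNReal} (hv : v ≠ 0) (t : ℝ) :
    HasDerivAt (gaussianPDFReal 0 v) (-(t / v) * gaussianPDFReal 0 v t) t := by
  have hv' : (v : ℝ) ≠ 0 := NNReal.coe_ne_zero.mpr hv
  have hexp : HasDerivAt (fun s : ℝ => -(s - 0) ^ 2 / (2 * v)) (-(t / v)) t := by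
    have := ((((hasDerivAt_id t).sub_const 0).pow 2).neg).div_const (2 * (v : ℝ))
    refine this.congr_deriv ?_
    simp
    field_simp
  have := hexp.exp.const_mul (√(2 * Real.pi * v))⁻¹
  refine this.congr_deriv ?_
  simp only [gaussianPDFReal]
  ring

/-- A continuous function is integrable against a locally finite measure on `ℝ` as soon as its
product with the identity is. -/
lemma Continuous.integrable_of_integrable_id_mul {μ : Measure ℝ} [IsLocallyFiniteMeasure μ]
    {g : ℝ → ℝ} (hg : Continuous g) (hint : Integrable (fun t => t * g t) μ) :
    Integrable g μ := by
  rw [← integrableOn_univ, ← Set.union_compl_self (Set.Icc (-1 : ℝ) 1)]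
  refine (hg.continuousOn.integrableOn_compact isCompact_Icc).union ?_
  refine Integrable.mono hint.integrableOn hg.aestronglyMeasurable ?_
  refine (ae_restrict_iff' measurableSet_Icc.compl).mpr (ae_of_all _ fun t ht => ?_)
  have ht' : 1 ≤ |t| := by
    by_contra! hlt
    exact ht (abs_le.mp hlt.le)
  rw [norm_mul]
  exact le_mul_of_one_le_left (norm_nonneg _) ht'

/-- Stein's identity for a centered real Gaussian measure. -/
lemma integral_id_mul_gaussianReal {v : NNReal} (hv : v ≠ 0) {g g' : ℝ → ℝ}
    (hg : ∀ t, HasDerivAt g (g' t) t)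
    (hint : Integrable (fun t => t * g t) (gaussianReal 0 v))
    (hint' : Integrable g' (gaussianReal 0 v)) :
    ∫ t, t * g t ∂(gaussianReal 0 v) = v * ∫ t, g' t ∂(gaussianReal 0 v) := by
  have hv' : (v : ℝ) ≠ 0 := NNReal.coe_ne_zero.mpr hv
  have hcont : Continuous g := continuous_iff_continuousAt.mpr fun t => (hg t).continuousAt
  have density : ∀ f : ℝ → ℝ, Integrable f (gaussianReal 0 v) →
      Integrable (fun t => gaussianPDFReal 0 v t * f t) := by
    intro f hf
    rw [gaussianReal_of_var_ne_zero 0 hv, integrable_withDensity_iff_integrable_smul'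
      (measurable_gaussianPDF 0 v) (ae_of_all _ fun _ => gaussianPDF_lt_top)] at hf
    simpa only [toReal_gaussianPDF, smul_eq_mul] using hf
  have h₀ := density g (hcont.integrable_of_integrable_id_mul hint)
  have h₁ := density _ hint
  have h₂ := density _ hint'
  have hzero := integral_eq_zero_of_hasDerivAt_of_integrable
    (f' := fun t => gaussianPDFReal 0 v t * g' t
      - (v : ℝ)⁻¹ * (gaussianPDFReal 0 v t * (t * g t)))
    (fun t => ((hasDerivAt_gaussianPDFReal_zero_mean hv t).mul (hg t)).congr_deriv
      (by ring)) (h₂.sub (h₁.const_mul _)) h₀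
  rw [integral_sub h₂ (h₁.const_mul _), integral_const_mul, sub_eq_zero] at hzero
  simp only [integral_gaussianReal_eq_integral_smul hv, smul_eq_mul]
  rw [hzero, mul_inv_cancel_left₀ hv']

/-- Stein's identity in one coordinate of a product of centered real Gaussian measures. -/
lemma integral_eval_mul_pi_gaussianReal {m : ℕ} {v : NNReal} (hv : v ≠ 0) (i : Fin (m + 1))
    {g g' : (Fin (m + 1) → ℝ) → ℝ}
    (hg : ∀ n t, HasDerivAt (fun s => g (Function.update n i s)) (g' (Function.update n i t)) t)
    (hint : Integrable (fun n => n i * g n) (Measure.pi fun _ => gaussianReal 0 v))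
    (hint' : Integrable g' (Measure.pi fun _ => gaussianReal 0 v)) :
    ∫ n, n i * g n ∂(Measure.pi fun _ => gaussianReal 0 v)
      = v * ∫ n, g' n ∂(Measure.pi fun _ => gaussianReal 0 v) := by
  have hmp := (measurePreserving_piFinSuccAbove
    (fun _ : Fin (m + 1) => gaussianReal 0 v) i).symm
  have hprod := (hmp.integrable_comp_emb (MeasurableEquiv.measurableEmbedding _)).mpr hint
  have hprod' := (hmp.integrable_comp_emb (MeasurableEquiv.measurableEmbedding _)).mpr hint'
  rw [← hmp.integral_comp', ← hmp.integral_comp']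
  refine (integral_prod_symm _ hprod).trans ?_
  refine Eq.trans ?_ (congrArg (fun r => (v : ℝ) * r) (integral_prod_symm _ hprod').symm)
  rw [← integral_const_mul]
  refine integral_congr_ae ?_
  filter_upwards [hprod.prod_left_ae, hprod'.prod_left_ae] with z hz hz'
  have hins : ∀ t : ℝ, (MeasurableEquiv.piFinSuccAbove (fun _ => ℝ) i).symm (t, z)
      = Function.update (i.insertNth (α := fun _ => ℝ) 0 z) i t := fun t => by
    rw [Fin.update_insertNth]
    rfl
  simp only [Function.comp_apply, hins, Function.update_self] at hz hz' ⊢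
  exact integral_id_mul_gaussianReal hv (hg _) hz hz'

/-- **Multivariate Stein identity.** For `y = x + n` with `n` having i.i.d. `N(0, σ²)`
coordinates and `h : ℝ^K → ℝ^K` continuously differentiable with the stated
integrability, `E[nᵀ h(y)] = σ² E[∑ᵢ ∂hᵢ/∂yᵢ (y)]`. -/
theorem multivariate_stein_identity (K : ℕ) (hK : 1 ≤ K) (σ : ℝ) (hσ : 0 < σ)
    (x : Fin K → ℝ) (h : (Fin K → ℝ) → (Fin K → ℝ)) (hh : ContDiff ℝ 1 h)
    (hint₁ : ∀ i, Integrable (fun n => n i * h (x + n) i) (gaussPi K σ))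
    (hint₂ : ∀ i, Integrable (fun n => fderiv ℝ h (x + n) (Pi.single i 1) i) (gaussPi K σ)) :
    ∫ n, ∑ i, n i * h (x + n) i ∂(gaussPi K σ)
      = σ ^ 2 * ∫ n, ∑ i, fderiv ℝ h (x + n) (Pi.single i 1) i ∂(gaussPi K σ) := by
  obtain ⟨m, rfl⟩ := Nat.exists_eq_add_of_le' hK
  have hv : (σ ^ 2).toNNReal ≠ 0 := (Real.toNNReal_pos.mpr (by positivity)).ne'
  rw [integral_finsetSum _ fun i _ => hint₁ i, integral_finsetSum _ fun i _ => hint₂ i,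
    Finset.mul_sum]
  refine Finset.sum_congr rfl fun i _ => ?_
  have hderiv : ∀ (n : Fin (m + 1) → ℝ) (t : ℝ),
      HasDerivAt (fun s => h (x + Function.update n i s) i)
        (fderiv ℝ h (x + Function.update n i t) (Pi.single i 1) i) t := fun n t =>
    hasDerivAt_pi.mp (((hh.differentiable one_ne_zero _).hasFDerivAt).comp_hasDerivAt t
      ((hasDerivAt_update n i t).const_add x)) i
  have := integral_eval_mul_pi_gaussianReal hv i hderiv (hint₁ i) (hint₂ i)
  rwa [Real.coe_toNNReal _ (sq_nonneg σ)] at this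
end

section
/- Fix K ≥ 1 and y ∈ ℝ^K. Let h : ℝ^K → ℝ^K be globally Lipschitz and differentiable at y, and let ñ be a random vector in ℝ^K whose coordinates are independent with common distribution N(0, 1). Then lim_{ε → 0⁺} E_ñ[ ñᵀ (h(y + ε ñ) − h(y)) / ε ] = Σ_{i=1}^K (∂h_i/∂y_i)(y). -/
open MeasureTheory ProbabilityTheory Filter

/-- The law of a random vector in `ℝ^K` with i.i.d. standard normal coordinates. -/
noncomputable def stdGaussPi (K : ℕ) : Measure (Fin K → ℝ) :=
  Measure.pi fun _ => gaussianReal 0 1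

lemma measurePreserving_eval_stdGaussPi {K : ℕ} (i : Fin K) :
    MeasurePreserving (fun n : Fin K → ℝ => n i) (stdGaussPi K) (gaussianReal 0 1) :=
  measurePreserving_eval (fun _ : Fin K => gaussianReal 0 1) i

lemma memLp_eval_stdGaussPi {K : ℕ} (i : Fin K) :
    MemLp (fun n : Fin K → ℝ => n i) 2 (stdGaussPi K) :=
  (memLp_id_gaussianReal 2).comp_measurePreserving (measurePreserving_eval_stdGaussPi i)

lemma integral_eval_stdGaussPi {K : ℕ} (i : Fin K) : ∫ n, n i ∂(stdGaussPi K) = 0 := by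
  have hmp := measurePreserving_eval_stdGaussPi i
  have hmap := integral_map (f := id) hmp.aemeasurable aestronglyMeasurable_id
  rw [hmp.map_eq] at hmap
  simpa using hmap.symm

/-- The coordinates of a standard Gaussian vector have identity covariance. -/
lemma integral_mul_stdGaussPi {K : ℕ} (i j : Fin K) :
    ∫ n, n i * n j ∂(stdGaussPi K) = if j = i then 1 else 0 := by
  have hmp := measurePreserving_eval_stdGaussPi i
  split_ifs with hji
  · subst hji
    have hvar : Var[fun n : Fin K → ℝ => n j; stdGaussPi K] = 1 := by
      rw [← variance_id_map hmp.aemeasurable, hmp.map_eq, variance_id_gaussianReal]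
      simp
    rw [variance_of_integral_eq_zero hmp.aemeasurable (integral_eval_stdGaussPi j)] at hvar
    simpa [sq] using hvar
  · have hind : iIndepFun (fun (k : Fin K) (n : Fin K → ℝ) => n k) (stdGaussPi K) :=
      iIndepFun_pi (X := fun _ => id) fun _ => aemeasurable_id
    rw [(hind.indepFun (Ne.symm hji)).integral_fun_mul_eq_mul_integral
      (memLp_eval_stdGaussPi i).1 (memLp_eval_stdGaussPi j).1, integral_eval_stdGaussPi, zero_mul]

/-- Hutchinson's identity: the expected quadratic form of a standard Gaussian vector is the
trace. -/
lemma integral_sum_mul_apply_stdGaussPi {K : ℕ} (A : (Fin K → ℝ) →L[ℝ] (Fin K → ℝ)) :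
    ∫ n, ∑ i, n i * A n i ∂(stdGaussPi K) = ∑ i, A (Pi.single i 1) i := by
  have hA (n : Fin K → ℝ) (i : Fin K) : A n i = ∑ j, n j * A (Pi.single j 1) i := by
    conv_lhs => rw [pi_eq_sum_univ' n]
    simp [Finset.sum_apply]
  have hint (i j : Fin K) :
      Integrable (fun n : Fin K → ℝ => n i * n j * A (Pi.single j 1) i) (stdGaussPi K) :=
    ((memLp_eval_stdGaussPi i).integrable_mul (memLp_eval_stdGaussPi j)).mul_const _
  have hquad (n : Fin K → ℝ) :
      ∑ i, n i * A n i = ∑ i, ∑ j, n i * n j * A (Pi.single j 1) i :=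
    Finset.sum_congr rfl fun i _ => by simp only [hA n i, Finset.mul_sum, mul_assoc]
  simp_rw [hquad]
  rw [integral_finsetSum _ fun i _ => integrable_finsetSum _ fun j _ => hint i j]
  refine Finset.sum_congr rfl fun i _ => ?_
  rw [integral_finsetSum _ fun j _ => hint i j]
  simp [integral_mul_const, integral_mul_stdGaussPi]

/-- **Monte-Carlo SURE divergence approximation (Theorem 2 of the paper).**
If `h : ℝ^K → ℝ^K` is globally Lipschitz and differentiable at `y`, and `ñ` has i.i.d.
`N(0,1)` coordinates, then
`lim_{ε → 0⁺} E[ñᵀ (h(y + εñ) − h(y)) / ε] = ∑ᵢ ∂hᵢ/∂yᵢ(y)`. -/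
theorem mc_sure_divergence (K : ℕ) (hK : 1 ≤ K) (y : Fin K → ℝ)
    (h : (Fin K → ℝ) → (Fin K → ℝ))
    (hLip : ∃ L : NNReal, LipschitzWith L h)
    (hdiff : DifferentiableAt ℝ h y) :
    Tendsto
      (fun ε : ℝ => ∫ n, (∑ i, n i * (h (y + ε • n) i - h y i)) / ε ∂(stdGaussPi K))
      (nhdsWithin 0 (Set.Ioi 0))
      (nhds (∑ i, fderiv ℝ h y (Pi.single i 1) i)) := by
  obtain ⟨L, hL⟩ := hLip
  rw [← integral_sum_mul_apply_stdGaussPi]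
  refine tendsto_integral_filter_of_dominated_convergence
    (fun n => L * (∑ i, |n i|) ^ 2) (.of_forall fun ε => ?_) ?_ ?_ (.of_forall fun n => ?_)
  · have hcont := hL.continuous
    exact Continuous.aestronglyMeasurable (by fun_prop)
  · filter_upwards [self_mem_nhdsWithin] with ε (hε : 0 < ε)
    refine .of_forall fun n => ?_
    have hnorm : ‖n‖ ≤ ∑ i, |n i| :=
      (pi_norm_le_iff_of_nonneg (by positivity)).2 fun i =>
        Finset.single_le_sum (f := fun i => |n i|) (fun _ _ => abs_nonneg _) (Finset.mem_univ i)
    have hh (i : Fin K) : |h (y + ε • n) i - h y i| ≤ ε * (L * ∑ i, |n i|) := by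
      calc |h (y + ε • n) i - h y i| ≤ ‖h (y + ε • n) - h y‖ :=
            norm_le_pi_norm (h (y + ε • n) - h y) i
        _ ≤ L * ‖y + ε • n - y‖ := hL.norm_sub_le _ _
        _ = ε * (L * ‖n‖) := by
            rw [add_sub_cancel_left, norm_smul, Real.norm_of_nonneg hε.le]; ring
        _ ≤ ε * (L * ∑ i, |n i|) := by gcongr
    rw [norm_div, Real.norm_of_nonneg hε.le, div_le_iff₀ hε]
    calc ‖∑ i, n i * (h (y + ε • n) i - h y i)‖
        ≤ ∑ i, |n i| * (ε * (L * ∑ i, |n i|)) := by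
          refine norm_sum_le_of_le _ fun i _ => ?_
          rw [norm_mul]
          exact mul_le_mul_of_nonneg_left (hh i) (abs_nonneg _)
      _ = L * (∑ i, |n i|) ^ 2 * ε := by rw [← Finset.sum_mul]; ring
  · exact (memLp_finsetSum _ fun i _ => (memLp_eval_stdGaussPi i).abs).integrable_sq.const_mul _
  · have hslope := (hdiff.hasFDerivAt.hasLineDerivAt n).tendsto_slope_zero_right
    rw [tendsto_pi_nhds] at hslope
    refine (tendsto_finsetSum _ fun i _ => (hslope i).const_mul (n i)).congr fun ε => ?_
    rw [Finset.sum_div]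
    refine Finset.sum_congr rfl fun i _ => ?_
    simp only [Pi.smul_apply, Pi.sub_apply, smul_eq_mul]
    ring
end

section
/- Fix K ≥ 1 and x ∈ (0, ∞)^K. Let y be a random vector in ℕ^K whose coordinates y_1, …, y_K are independent with y_i Poisson-distributed with mean x_i, and let h : ℕ^K → ℝ^K be such that all expectations below exist. Then E[‖x − h(y)‖²] = E[ ‖y − h(y)‖² − Σ_{i=1}^K y_i + 2 Σ_{i=1}^K y_i (h_i(y) − h_i(y − e_i)) ], where e_i is the i-th standard basis vector and each summand y_i (h_i(y) − h_i(y − e_i)) is interpreted as 0 when y_i = 0. In particular, the right-hand side integrand is an unbiased estimator of the mean squared error that does not involve the unknown x. -/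
open MeasureTheory ProbabilityTheory

/-- The law of a random vector in `ℕ^K` whose coordinates are independent, with the `i`-th
coordinate Poisson-distributed with mean `x i`. -/
noncomputable def poissonPi (K : ℕ) (x : Fin K → ℝ) : Measure (Fin K → ℕ) :=
  Measure.pi fun i => poissonMeasure (x i).toNNReal

open scoped NNReal ENNReal Nat

instance (K : ℕ) (x : Fin K → ℝ) : IsProbabilityMeasure (poissonPi K x) := by
  unfold poissonPi
  infer_instance

lemma succ_mul_poissonMeasure_singleton_succ (r : ℝ≥0) (n : ℕ) :
    ((n + 1 : ℕ) : ℝ≥0∞) * poissonMeasure r {n + 1} = r * poissonMeasure r {n} := by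
  rw [poissonMeasure_singleton, poissonMeasure_singleton, ← ENNReal.ofReal_natCast,
    ← ENNReal.ofReal_coe_nnreal, ← ENNReal.ofReal_mul (by positivity),
    ← ENNReal.ofReal_mul (by positivity), Nat.factorial_succ]
  congr 1
  push_cast
  field_simp
  ring

lemma poissonPi_singleton (K : ℕ) (x : Fin K → ℝ) (y : Fin K → ℕ) :
    poissonPi K x {y} = ∏ i, poissonMeasure (x i).toNNReal {y i} := by
  rw [poissonPi, Measure.pi_singleton]

/-- Size-biasing the `i`-th coordinate of a Poisson vector shifts it by one. -/
lemma withDensity_poissonPi (K : ℕ) (x : Fin K → ℝ) (i : Fin K) :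
    (poissonPi K x).withDensity (fun y => ((y i : ℝ≥0) : ℝ≥0∞)) =
      (x i).toNNReal • (poissonPi K x).map (fun y => Function.update y i (y i + 1)) := by
  refine Measure.ext_of_singleton fun y => ?_
  rw [withDensity_apply _ (measurableSet_singleton y), lintegral_singleton, Measure.smul_apply,
    Measure.map_apply .of_discrete (measurableSet_singleton y)]
  rcases hy : y i with _ | n
  · have hempty : (fun z : Fin K → ℕ => Function.update z i (z i + 1)) ⁻¹' {y} = ∅ := by
      ext z
      simp only [Set.mem_preimage, Set.mem_singleton_iff, Set.mem_empty_iff_false, iff_false]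
      rintro rfl
      simp at hy
    simp [hempty]
  · have hsingle : (fun z : Fin K → ℕ => Function.update z i (z i + 1)) ⁻¹' {y} =
        {Function.update y i n} := by
      ext z
      simp only [Set.mem_preimage, Set.mem_singleton_iff]
      constructor
      · rintro rfl
        have hz : z i = n := by simpa using hy
        simp [← hz]
      · rintro rfl
        simp [← hy]
    rw [hsingle, poissonPi_singleton, poissonPi_singleton,
      ← Finset.mul_prod_erase _ _ (Finset.mem_univ i),
      ← Finset.mul_prod_erase _ (fun j => poissonMeasure (x j).toNNReal {Function.update y i n j})
        (Finset.mem_univ i), ENNReal.smul_def, smul_eq_mul, ← mul_assoc, ← mul_assoc, hy,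
      Function.update_self]
    congr 1
    · rw [← succ_mul_poissonMeasure_singleton_succ]
      simp
    · refine Finset.prod_congr rfl fun j hj => ?_
      rw [Function.update_of_ne (Finset.ne_of_mem_erase hj)]

/-- The Stein–Chen identity for a Poisson vector. -/
lemma integral_coord_mul_poissonPi (K : ℕ) (x : Fin K → ℝ) (i : Fin K) (hx : 0 ≤ x i)
    (f : (Fin K → ℕ) → ℝ) :
    ∫ y, (y i : ℝ) * f y ∂(poissonPi K x) =
      x i * ∫ y, f (Function.update y i (y i + 1)) ∂(poissonPi K x) := by
  have key := congrArg (fun μ => ∫ y, f y ∂μ) (withDensity_poissonPi K x i)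
  rw [integral_withDensity_eq_integral_smul .of_discrete, integral_smul_nnreal_measure,
    integral_map .of_discrete .of_discrete] at key
  simpa [NNReal.smul_def, hx] using key

lemma integrable_coord_mul_poissonPi (K : ℕ) (x : Fin K → ℝ) (i : Fin K)
    (f : (Fin K → ℕ) → ℝ)
    (hf : Integrable (fun y => f (Function.update y i (y i + 1))) (poissonPi K x)) :
    Integrable (fun y => (y i : ℝ) * f y) (poissonPi K x) := by
  have hmap : Integrable f
      ((poissonPi K x).map (fun y => Function.update y i (y i + 1))) :=
    (integrable_map_measure .of_discrete .of_discrete).2 hf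
  have hdens := hmap.smul_measure_nnreal (c := (x i).toNNReal)
  rw [← withDensity_poissonPi, integrable_withDensity_iff_integrable_smul .of_discrete] at hdens
  simpa [NNReal.smul_def] using hdens

/-- The coordinatewise unbiasedness identity, for a real-valued square-integrable `g`. -/
lemma integrable_and_integral_pure_coord (K : ℕ) (x : Fin K → ℝ) (i : Fin K) (hx : 0 ≤ x i)
    (g : (Fin K → ℕ) → ℝ) (hg : Integrable (fun y => (x i - g y) ^ 2) (poissonPi K x)) :
    Integrable (fun y => ((y i : ℝ) - g y) ^ 2 - (y i : ℝ)
        + 2 * ((y i : ℝ) * (g y - g (Function.update y i (y i - 1))))) (poissonPi K x) ∧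
      ∫ y, (((y i : ℝ) - g y) ^ 2 - (y i : ℝ)
        + 2 * ((y i : ℝ) * (g y - g (Function.update y i (y i - 1))))) ∂(poissonPi K x) =
      ∫ y, (x i - g y) ^ 2 ∂(poissonPi K x) := by
  have hg1 : Integrable g (poissonPi K x) := by
    have hmem := ((memLp_two_iff_integrable_sq .of_discrete).2 hg).integrable one_le_two
    exact ((integrable_const (x i)).sub hmem).congr (.of_forall fun y => sub_sub_cancel _ _)
  have hy : Integrable (fun y : Fin K → ℕ => (y i : ℝ)) (poissonPi K x) := by
    simpa using integrable_coord_mul_poissonPi K x i (fun _ => 1) (integrable_const 1)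
  have hy_mean : ∫ y : Fin K → ℕ, (y i : ℝ) ∂(poissonPi K x) = x i := by
    simpa using integral_coord_mul_poissonPi K x i hx (fun _ => 1)
  have hyy : Integrable (fun y : Fin K → ℕ => (y i : ℝ) * ((y i : ℝ) - 1)) (poissonPi K x) :=
    integrable_coord_mul_poissonPi K x i (fun y => (y i : ℝ) - 1) (by simpa using hy)
  have hyy_mean : ∫ y : Fin K → ℕ, (y i : ℝ) * ((y i : ℝ) - 1) ∂(poissonPi K x) = x i * x i := by
    simpa [hy_mean] using integral_coord_mul_poissonPi K x i hx (fun y => (y i : ℝ) - 1)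
  have hyg : Integrable (fun y : Fin K → ℕ => (y i : ℝ) * g (Function.update y i (y i - 1)))
      (poissonPi K x) :=
    integrable_coord_mul_poissonPi K x i (fun y => g (Function.update y i (y i - 1)))
      (by simpa using hg1)
  have hyg_mean : ∫ y : Fin K → ℕ, (y i : ℝ) * g (Function.update y i (y i - 1)) ∂(poissonPi K x) =
      x i * ∫ y, g y ∂(poissonPi K x) := by
    simpa using integral_coord_mul_poissonPi K x i hx
      (fun y => g (Function.update y i (y i - 1)))
  have hdecomp : (fun y : Fin K → ℕ => ((y i : ℝ) - g y) ^ 2 - (y i : ℝ)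
        + 2 * ((y i : ℝ) * (g y - g (Function.update y i (y i - 1))))) =
      fun y => (x i - g y) ^ 2 + (((y i : ℝ) * ((y i : ℝ) - 1) - x i * x i)
        + (2 * x i * g y - 2 * ((y i : ℝ) * g (Function.update y i (y i - 1))))) := by
    ext y
    ring
  have hfactorial : Integrable (fun y : Fin K → ℕ => (y i : ℝ) * ((y i : ℝ) - 1) - x i * x i)
      (poissonPi K x) := hyy.sub (integrable_const (x i * x i))
  have hcross : Integrable (fun y : Fin K → ℕ => 2 * x i * g y
      - 2 * ((y i : ℝ) * g (Function.update y i (y i - 1)))) (poissonPi K x) :=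
    (hg1.const_mul (2 * x i)).sub (hyg.const_mul 2)
  rw [hdecomp]
  have hremainder : Integrable (fun y : Fin K → ℕ => ((y i : ℝ) * ((y i : ℝ) - 1) - x i * x i)
      + (2 * x i * g y - 2 * ((y i : ℝ) * g (Function.update y i (y i - 1))))) (poissonPi K x) :=
    hfactorial.add hcross
  refine ⟨hg.add hremainder, ?_⟩
  rw [integral_add hg hremainder, integral_add hfactorial hcross,
    integral_sub hyy (integrable_const _), integral_sub (hg1.const_mul _) (hyg.const_mul _),
    integral_const_mul (2 * x i), integral_const_mul 2, hyy_mean, hyg_mean, integral_const,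
    probReal_univ, one_smul]
  ring

/-- **PURE (Poisson unbiased risk estimator, gain `ζ = 1`, no Gaussian noise).**
If `y` has independent coordinates with `yᵢ ~ Poisson(xᵢ)`, `xᵢ > 0`, and
`h : ℕ^K → ℝ^K` is such that the stated expectations exist, then
`E[‖x − h(y)‖²] = E[‖y − h(y)‖² − ∑ᵢ yᵢ + 2 ∑ᵢ yᵢ (hᵢ(y) − hᵢ(y − eᵢ))]`,
where each summand `yᵢ (hᵢ(y) − hᵢ(y − eᵢ))` is interpreted as `0` when `yᵢ = 0`
(here via truncated subtraction, since the factor `yᵢ` vanishes). -/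
theorem pure_unbiased (K : ℕ) (hK : 1 ≤ K) (x : Fin K → ℝ)
    (hx : ∀ i, 0 < x i) (h : (Fin K → ℕ) → (Fin K → ℝ))
    (hint₀ : Integrable (fun y => ∑ i, (x i - h y i) ^ 2) (poissonPi K x))
    (hint₁ : Integrable (fun y => ∑ i, ((y i : ℝ) - h y i) ^ 2) (poissonPi K x))
    (hint₂ : Integrable (fun y => ∑ i, (y i : ℝ)) (poissonPi K x))
    (hint₃ : Integrable (fun y => ∑ i, (y i : ℝ) *
        (h y i - h (Function.update y i (y i - 1)) i)) (poissonPi K x)) :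
    ∫ y, ∑ i, (x i - h y i) ^ 2 ∂(poissonPi K x)
      = ∫ y, (∑ i, ((y i : ℝ) - h y i) ^ 2 - ∑ i, (y i : ℝ)
          + 2 * ∑ i, (y i : ℝ) * (h y i - h (Function.update y i (y i - 1)) i))
          ∂(poissonPi K x) := by
  have hcoord (i : Fin K) : Integrable (fun y => (x i - h y i) ^ 2) (poissonPi K x) := by
    refine hint₀.mono' .of_discrete (.of_forall fun y => ?_)
    rw [Real.norm_of_nonneg (sq_nonneg _)]
    exact Finset.single_le_sum (f := fun j => (x j - h y j) ^ 2) (fun j _ => sq_nonneg _)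
      (Finset.mem_univ i)
  have hpure (i : Fin K) := integrable_and_integral_pure_coord K x i (hx i).le
    (fun y => h y i) (hcoord i)
  simp_rw [Finset.mul_sum, ← Finset.sum_sub_distrib, ← Finset.sum_add_distrib]
  rw [integral_finsetSum _ fun i _ => hcoord i, integral_finsetSum _ fun i _ => (hpure i).1]
  exact Finset.sum_congr rfl fun i _ => (hpure i).2.symm
end
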